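/- arXiv:2407.07568 — 4 statements merged into one kernel-verified Lean document; each statement's English description precedes it below -/
import Mathlib

section
/- A point x = (x_α)_{α∈P} ∈ ℝ_{≥0}^{P} belongs to X_{𝐦,M} (i.e. satisfies Σ_{α∈P'} x_α ≤ M + Σ_{d=1}^{n−1} m_d·w(P'∩P_d) for every subset P' ⊆ P) if and only if for every finite collection C_1, …, C_r of nonempty chains in P one has Σ_{α ∈ C_1∪…∪C_r} x_α ≤ M + Σ_{a=1}^{r} (m_{s(C_a)} + m_{s(C_a)+1} + … + m_{f(C_a)−1}). -/
/-!
Fix `n ≥ 2`.  `P = {(i,j) : 1 ≤ j < i ≤ n}` with the componentwise partial order,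
`P_d = {(i,j) ∈ P : i > d ≥ j}`.  The width `w(Q)` of a finite `Q ⊆ P` is the maximal
cardinality of an antichain contained in `Q`.  For a nonempty chain `C`, `s(C)` is the
second coordinate of its minimal element and `f(C)` the first coordinate of its maximal
element.
-/

/-- The poset `P` of pairs `(i,j)` with `1 ≤ j < i ≤ n`. -/
def posetP (n : ℕ) : Finset (ℕ × ℕ) :=
  (Finset.range (n + 1) ×ˢ Finset.range (n + 1)).filter
    (fun p => 1 ≤ p.2 ∧ p.2 < p.1 ∧ p.1 ≤ n)

/-- The subposet `P_d = {(i,j) ∈ P : i > d ≥ j}`. -/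
def posetPd (n d : ℕ) : Finset (ℕ × ℕ) :=
  (posetP n).filter (fun p => d < p.1 ∧ p.2 ≤ d)

/-- The width of a finite subset of `ℕ × ℕ` (with the componentwise order):
the maximal cardinality of an antichain contained in it. -/
noncomputable def finWidth (Q : Finset (ℕ × ℕ)) : ℕ :=
  sSup (Finset.card '' {A : Finset (ℕ × ℕ) |
    A ⊆ Q ∧ IsAntichain (· ≤ ·) (A : Set (ℕ × ℕ))})

/-- `s(C)`: the second coordinate of the minimal element of a (nonempty) chain `C`. -/
noncomputable def chainS (C : Finset (ℕ × ℕ)) : ℕ :=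
  sInf (Prod.snd '' (C : Set (ℕ × ℕ)))

/-- `f(C)`: the first coordinate of the maximal element of a (nonempty) chain `C`. -/
noncomputable def chainF (C : Finset (ℕ × ℕ)) : ℕ :=
  sSup (Prod.fst '' (C : Set (ℕ × ℕ)))

lemma mem_posetP {n : ℕ} {p : ℕ × ℕ} : p ∈ posetP n ↔ 1 ≤ p.2 ∧ p.2 < p.1 ∧ p.1 ≤ n := by
  simp only [posetP, Finset.mem_filter, Finset.mem_product, Finset.mem_range]
  omega

lemma mem_posetPd {n d : ℕ} {p : ℕ × ℕ} :
    p ∈ posetPd n d ↔ p ∈ posetP n ∧ d < p.1 ∧ p.2 ≤ d := by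
  simp [posetPd]

lemma bddAbove_card_antichains (Q : Finset (ℕ × ℕ)) :
    BddAbove (Finset.card '' {A : Finset (ℕ × ℕ) |
      A ⊆ Q ∧ IsAntichain (· ≤ ·) (A : Set (ℕ × ℕ))}) := by
  refine ⟨Q.card, ?_⟩
  rintro _ ⟨A, hA, rfl⟩
  exact Finset.card_le_card hA.1

lemma card_le_finWidth {Q A : Finset (ℕ × ℕ)} (hAQ : A ⊆ Q)
    (hA : IsAntichain (· ≤ ·) (A : Set (ℕ × ℕ))) : A.card ≤ finWidth Q :=
  le_csSup (bddAbove_card_antichains Q) ⟨A, ⟨hAQ, hA⟩, rfl⟩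

lemma exists_antichain_card_eq_finWidth (Q : Finset (ℕ × ℕ)) :
    ∃ A ⊆ Q, IsAntichain (· ≤ ·) (A : Set (ℕ × ℕ)) ∧ A.card = finWidth Q := by
  have h := Nat.sSup_mem (s := Finset.card '' {A : Finset (ℕ × ℕ) |
      A ⊆ Q ∧ IsAntichain (· ≤ ·) (A : Set (ℕ × ℕ))})
    ⟨_, ∅, ⟨Finset.empty_subset _, by simp⟩, rfl⟩ (bddAbove_card_antichains Q)
  obtain ⟨A, ⟨hAQ, hA⟩, hc⟩ := h
  exact ⟨A, hAQ, hA, hc⟩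

lemma chainS_le {C : Finset (ℕ × ℕ)} {p : ℕ × ℕ} (hp : p ∈ C) : chainS C ≤ p.2 :=
  Nat.sInf_le ⟨p, hp, rfl⟩

lemma le_chainF {C : Finset (ℕ × ℕ)} {p : ℕ × ℕ} (hp : p ∈ C) : p.1 ≤ chainF C :=
  le_csSup (C.finite_toSet.image _).bddAbove ⟨p, hp, rfl⟩

lemma exists_snd_eq_chainS {C : Finset (ℕ × ℕ)} (hC : C.Nonempty) :
    ∃ p ∈ C, p.2 = chainS C :=
  Nat.sInf_mem (s := Prod.snd '' (C : Set (ℕ × ℕ))) (hC.to_set.image _)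

lemma exists_fst_eq_chainF {C : Finset (ℕ × ℕ)} (hC : C.Nonempty) :
    ∃ p ∈ C, p.1 = chainF C :=
  Nat.sSup_mem (s := Prod.fst '' (C : Set (ℕ × ℕ))) (hC.to_set.image _)
    (C.finite_toSet.image _).bddAbove

/-- An antichain meets each chain of a covering family at most once. -/
lemma card_antichain_le_of_cover {ι : Type*} [Fintype ι] {C : ι → Finset (ℕ × ℕ)}
    (hchain : ∀ a, IsChain (· ≤ ·) (C a : Set (ℕ × ℕ))) {A : Finset (ℕ × ℕ)}
    (hA : IsAntichain (· ≤ ·) (A : Set (ℕ × ℕ))) {T : Finset ι}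
    (hcover : ∀ p ∈ A, ∃ a ∈ T, p ∈ C a) : A.card ≤ T.card := by
  rcases A.eq_empty_or_nonempty with rfl | ⟨p₀, hp₀⟩
  · simp
  have : Nonempty ι := ⟨(hcover p₀ hp₀).choose⟩
  choose! f hfT hfC using hcover
  refine Finset.card_le_card_of_injOn f hfT fun p hp q hq hpq ↦ ?_
  by_contra hne
  have hqC : q ∈ C (f p) := hpq ▸ hfC q hq
  rcases hchain (f p) (hfC p hp) hqC hne with h | h
  · exact hA hp hq hne h
  · exact hA hq hp (Ne.symm hne) h

/-- The levels `d ∈ [1, n - 1]` met by `G`, i.e. those with `G ∩ P_d` nonempty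
when `G` is contained in `P`. -/
def coveredLevels (n : ℕ) (G : Finset (ℕ × ℕ)) : Finset ℕ :=
  (Finset.Icc 1 (n - 1)).filter fun d ↦ ∃ p ∈ G, p.2 ≤ d ∧ d < p.1

/-- `F` is a collection of nonempty chains in `P`. -/
def IsChainFamily (n : ℕ) (F : Finset (Finset (ℕ × ℕ))) : Prop :=
  ∀ C ∈ F, C ⊆ posetP n ∧ C.Nonempty ∧ IsChain (· ≤ ·) (C : Set (ℕ × ℕ))

lemma IsChainFamily.union {n : ℕ} {F F' : Finset (Finset (ℕ × ℕ))}
    (hF : IsChainFamily n F) (hF' : IsChainFamily n F') : IsChainFamily n (F ∪ F') := by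
  intro C hC
  rcases Finset.mem_union.mp hC with h | h
  · exact hF C h
  · exact hF' C h

lemma sum_union_le_add {ι : Type*} [DecidableEq ι] (F F' : Finset ι) (c : ι → ℕ) :
    ∑ C ∈ F ∪ F', c C ≤ ∑ C ∈ F, c C + ∑ C ∈ F', c C := by
  rw [← Finset.sum_union_inter]
  exact Nat.le_add_right _ _

/-- A chain can be cut into chains whose hulls `[s, f)` are covered without overlap
by the levels met by the chain. -/
lemma exists_chainFamily_of_isChain (n : ℕ) (m : ℕ → ℕ) (G : Finset (ℕ × ℕ))
    (hGP : G ⊆ posetP n) (hG : IsChain (· ≤ ·) (G : Set (ℕ × ℕ))) :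
    ∃ F : Finset (Finset (ℕ × ℕ)), IsChainFamily n F ∧ (∀ p ∈ G, ∃ C ∈ F, p ∈ C) ∧
      ∑ C ∈ F, ∑ d ∈ Finset.Ico (chainS C) (chainF C), m d ≤
        ∑ d ∈ coveredLevels n G, m d := by
  induction G using Finset.strongInduction with
  | H G ih =>
  rcases G.eq_empty_or_nonempty with rfl | hne
  · exact ⟨∅, by simp [IsChainFamily], by simp, by simp⟩
  obtain ⟨p, hp, hps⟩ := exists_snd_eq_chainS hne
  obtain ⟨q, hq, hqf⟩ := exists_fst_eq_chainF hne
  by_cases hgap : ∃ d ∈ Finset.Ico (chainS G) (chainF G), ∀ r ∈ G, r.2 ≤ d → r.1 ≤ d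
  · obtain ⟨d, hd, hgap⟩ := hgap
    rw [Finset.mem_Ico] at hd
    have hL : G.filter (fun r ↦ r.2 ≤ d) ⊂ G :=
      Finset.filter_ssubset.mpr ⟨q, hq, fun h ↦ by have := hgap q hq h; omega⟩
    have hR : G.filter (fun r ↦ ¬ r.2 ≤ d) ⊂ G :=
      Finset.filter_ssubset.mpr ⟨p, hp, by omega⟩
    obtain ⟨F, hF, hFc, hFs⟩ := ih _ hL (hL.subset.trans hGP)
      (hG.mono (Finset.coe_subset.mpr hL.subset))
    obtain ⟨F', hF', hFc', hFs'⟩ := ih _ hR (hR.subset.trans hGP)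
      (hG.mono (Finset.coe_subset.mpr hR.subset))
    refine ⟨F ∪ F', hF.union hF', fun r hr ↦ ?_, ?_⟩
    · by_cases h : r.2 ≤ d
      · obtain ⟨C, hC, hrC⟩ := hFc r (Finset.mem_filter.mpr ⟨hr, h⟩)
        exact ⟨C, Finset.mem_union_left _ hC, hrC⟩
      · obtain ⟨C, hC, hrC⟩ := hFc' r (Finset.mem_filter.mpr ⟨hr, h⟩)
        exact ⟨C, Finset.mem_union_right _ hC, hrC⟩
    · refine (sum_union_le_add _ _ _).trans ((Nat.add_le_add hFs hFs').trans ?_)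
      rw [← Finset.sum_union]
      · refine Finset.sum_le_sum_of_subset fun e he ↦ ?_
        simp only [coveredLevels, Finset.mem_union, Finset.mem_filter] at he ⊢
        rcases he with ⟨h1, r, hr, h2⟩ | ⟨h1, r, hr, h2⟩
        · exact ⟨h1, r, hr.1, h2⟩
        · exact ⟨h1, r, hr.1, h2⟩
      · rw [Finset.disjoint_left]
        intro e he he'
        simp only [coveredLevels, Finset.mem_filter] at he he'
        obtain ⟨-, r, ⟨hr, hrd⟩, h1, h2⟩ := he
        obtain ⟨-, r', ⟨hr', hrd'⟩, h1', h2'⟩ := he'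
        have := hgap r hr hrd
        omega
  · push Not at hgap
    refine ⟨{G}, ?_, fun r hr ↦ ⟨G, by simp, hr⟩, ?_⟩
    · intro C hC
      rw [Finset.mem_singleton] at hC
      subst hC
      exact ⟨hGP, hne, hG⟩
    · rw [Finset.sum_singleton]
      refine Finset.sum_le_sum_of_subset fun d hd ↦ ?_
      obtain ⟨r, hr, h1, h2⟩ := hgap d hd
      have := mem_posetP.mp (hGP hr)
      simp only [coveredLevels, Finset.mem_filter, Finset.mem_Icc]
      exact ⟨by omega, r, hr, h1, h2⟩

/-- The elements `(i,j)` of `Q` such that no `(i',j') ∈ Q` has `j' < j` and `i < i'`. -/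
def outerLayer (Q : Finset (ℕ × ℕ)) : Finset (ℕ × ℕ) :=
  Q.filter fun p ↦ ∀ q ∈ Q, ¬ (q.2 < p.2 ∧ p.1 < q.1)

lemma isChain_outerLayer (Q : Finset (ℕ × ℕ)) :
    IsChain (· ≤ ·) (outerLayer Q : Set (ℕ × ℕ)) := by
  intro p hp q hq _
  simp only [outerLayer, Finset.coe_filter, Set.mem_ofPred_eq] at hp hq
  have h1 := hp.2 q hq.1
  have h2 := hq.2 p hp.1
  simp only [Prod.le_def]
  omega

lemma exists_mem_outerLayer {Q : Finset (ℕ × ℕ)} {p : ℕ × ℕ} (hp : p ∈ Q) :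
    ∃ q ∈ outerLayer Q, q = p ∨ (q.2 < p.2 ∧ p.1 < q.1) := by
  obtain ⟨q, hq, hmax⟩ := (Q.filter fun q ↦ q = p ∨ (q.2 < p.2 ∧ p.1 < q.1)).exists_max_image
    Prod.fst ⟨p, by simp [hp]⟩
  rw [Finset.mem_filter] at hq
  refine ⟨q, Finset.mem_filter.mpr ⟨hq.1, fun r hr h ↦ ?_⟩, hq.2⟩
  have := hmax r (Finset.mem_filter.mpr ⟨hr, Or.inr ?_⟩)
  · omega
  · rcases hq.2 with rfl | h'
    · exact h
    · omega

/-- Removing the outer layer decreases the width of every nonempty `Q ∩ P_d`. -/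
lemma finWidth_sdiff_outerLayer_lt {n d : ℕ} {Q : Finset (ℕ × ℕ)}
    (hne : (Q ∩ posetPd n d).Nonempty) (hQ : Q ⊆ posetP n) :
    finWidth ((Q \ outerLayer Q) ∩ posetPd n d) < finWidth (Q ∩ posetPd n d) := by
  obtain ⟨A, hAQ, hA, hcard⟩ :=
    exists_antichain_card_eq_finWidth ((Q \ outerLayer Q) ∩ posetPd n d)
  rw [← hcard]
  have hAQ' : ∀ p ∈ A, (p ∈ Q ∧ p ∉ outerLayer Q) ∧ d < p.1 ∧ p.2 ≤ d := by
    intro p hp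
    have h := hAQ hp
    rw [Finset.mem_inter, Finset.mem_sdiff, mem_posetPd] at h
    exact ⟨h.1, h.2.2⟩
  obtain ⟨b, hb, hbd, hbA⟩ : ∃ b ∈ Q, (d < b.1 ∧ b.2 ≤ d) ∧
      ∀ p ∈ A, b.2 < p.2 ∧ p.1 < b.1 := by
    rcases A.eq_empty_or_nonempty with rfl | hAne
    · obtain ⟨b, hb⟩ := hne
      rw [Finset.mem_inter, mem_posetPd] at hb
      exact ⟨b, hb.1, hb.2.2, by simp⟩
    · obtain ⟨a, ha, hmin⟩ := A.exists_min_image Prod.snd hAne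
      obtain ⟨⟨haQ, hao⟩, had⟩ := hAQ' a ha
      obtain ⟨b, hb, rfl | hba⟩ := exists_mem_outerLayer haQ
      · exact absurd hb hao
      refine ⟨b, (Finset.mem_filter.mp hb).1, by omega, fun p hp ↦ ?_⟩
      have h1 := hmin p hp
      have h2 : p.1 ≤ a.1 := by
        by_contra h
        exact hA ha hp (by rintro rfl; omega) (Prod.le_def.mpr ⟨by omega, h1⟩)
      omega
  have hbnot : b ∉ A := fun h ↦ by have := hbA b h; omega
  rw [← Nat.succ_le_iff, Nat.succ_eq_add_one, ← Finset.card_insert_of_notMem hbnot]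
  refine card_le_finWidth (fun p hp ↦ ?_) ?_
  · rw [Finset.mem_inter, mem_posetPd]
    rcases Finset.mem_insert.mp hp with rfl | hp
    · exact ⟨hb, hQ hb, hbd⟩
    · have := hAQ' p hp
      exact ⟨this.1.1, hQ this.1.1, this.2⟩
  · rw [Finset.coe_insert, isAntichain_insert]
    refine ⟨hA, fun p hp _ ↦ ?_⟩
    have := hbA p hp
    simp only [Prod.le_def]
    omega

lemma finWidth_mono {Q Q' : Finset (ℕ × ℕ)} (h : Q ⊆ Q') : finWidth Q ≤ finWidth Q' := by
  obtain ⟨A, hAQ, hA, hcard⟩ := exists_antichain_card_eq_finWidth Q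
  exact hcard ▸ card_le_finWidth (hAQ.trans h) hA

/-- A simultaneous Dilworth theorem: every `Q ⊆ P` is covered by chains such that the number
of hulls `[s, f)` containing `d`, weighted by `m`, is at most the width of `Q ∩ P_d`. -/
lemma exists_chainFamily (n : ℕ) (m : ℕ → ℕ) (Q : Finset (ℕ × ℕ)) (hQ : Q ⊆ posetP n) :
    ∃ F : Finset (Finset (ℕ × ℕ)), IsChainFamily n F ∧ (∀ p ∈ Q, ∃ C ∈ F, p ∈ C) ∧
      ∑ C ∈ F, ∑ d ∈ Finset.Ico (chainS C) (chainF C), m d ≤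
        ∑ d ∈ Finset.Icc 1 (n - 1), m d * finWidth (Q ∩ posetPd n d) := by
  induction Q using Finset.strongInduction with
  | H Q ih =>
  rcases Q.eq_empty_or_nonempty with rfl | ⟨p, hp⟩
  · exact ⟨∅, by simp [IsChainFamily], by simp, by simp⟩
  have hGQ : outerLayer Q ⊆ Q := Finset.filter_subset _ _
  obtain ⟨b, hb, -⟩ := exists_mem_outerLayer hp
  obtain ⟨F, hF, hFc, hFs⟩ := exists_chainFamily_of_isChain n m (outerLayer Q)
    (hGQ.trans hQ) (isChain_outerLayer Q)
  obtain ⟨F', hF', hFc', hFs'⟩ := ih _ (Finset.sdiff_ssubset hGQ ⟨b, hb⟩)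
    (Finset.sdiff_subset.trans hQ)
  refine ⟨F ∪ F', hF.union hF', fun r hr ↦ ?_, ?_⟩
  · by_cases h : r ∈ outerLayer Q
    · obtain ⟨C, hC, hrC⟩ := hFc r h
      exact ⟨C, Finset.mem_union_left _ hC, hrC⟩
    · obtain ⟨C, hC, hrC⟩ := hFc' r (Finset.mem_sdiff.mpr ⟨hr, h⟩)
      exact ⟨C, Finset.mem_union_right _ hC, hrC⟩
  · refine (sum_union_le_add _ _ _).trans ((Nat.add_le_add hFs hFs').trans ?_)
    rw [coveredLevels, Finset.sum_filter, ← Finset.sum_add_distrib]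
    refine Finset.sum_le_sum fun d _ ↦ ?_
    split_ifs with h
    · obtain ⟨q, hq, h1, h2⟩ := h
      have hlt := finWidth_sdiff_outerLayer_lt (n := n) (d := d)
        ⟨q, Finset.mem_inter.mpr ⟨hGQ hq, mem_posetPd.mpr ⟨hQ (hGQ hq), h2, h1⟩⟩⟩ hQ
      calc m d + m d * finWidth ((Q \ outerLayer Q) ∩ posetPd n d)
          = m d * (finWidth ((Q \ outerLayer Q) ∩ posetPd n d) + 1) := by ring
        _ ≤ _ := Nat.mul_le_mul_left _ hlt
    · rw [zero_add]
      exact Nat.mul_le_mul_left _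
        (finWidth_mono (Finset.inter_subset_inter_right Finset.sdiff_subset))

/-- The widths of the `P_d`-parts of a union of chains are bounded by the hulls. -/
lemma sum_mul_finWidth_biUnion_le {n : ℕ} (m : ℕ → ℕ) {ι : Type*} [Fintype ι]
    {C : ι → Finset (ℕ × ℕ)} (hchain : ∀ a, IsChain (· ≤ ·) (C a : Set (ℕ × ℕ))) :
    ∑ d ∈ Finset.Icc 1 (n - 1), m d * finWidth (Finset.univ.biUnion C ∩ posetPd n d) ≤
      ∑ a, ∑ d ∈ Finset.Ico (chainS (C a)) (chainF (C a)), m d := by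
  have hw : ∀ d, finWidth (Finset.univ.biUnion C ∩ posetPd n d) ≤
      (Finset.univ.filter fun a ↦ d ∈ Finset.Ico (chainS (C a)) (chainF (C a))).card := by
    intro d
    obtain ⟨A, hAQ, hA, hcard⟩ :=
      exists_antichain_card_eq_finWidth (Finset.univ.biUnion C ∩ posetPd n d)
    rw [← hcard]
    refine card_antichain_le_of_cover hchain hA fun p hp ↦ ?_
    have h := hAQ hp
    simp only [Finset.mem_inter, Finset.mem_biUnion, Finset.mem_univ, true_and,
      mem_posetPd] at h
    obtain ⟨⟨a, ha⟩, -, h1, h2⟩ := h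
    have hs := chainS_le ha
    have hf := le_chainF ha
    exact ⟨a, by simp only [Finset.mem_filter, Finset.mem_univ, true_and, Finset.mem_Ico]; omega,
      ha⟩
  calc _ ≤ ∑ d ∈ Finset.Icc 1 (n - 1), ∑ a,
        if d ∈ Finset.Ico (chainS (C a)) (chainF (C a)) then m d else 0 := by
        refine Finset.sum_le_sum fun d _ ↦ (Nat.mul_le_mul_left _ (hw d)).trans_eq ?_
        rw [← Finset.sum_filter, Finset.sum_const, smul_eq_mul, mul_comm]
    _ = ∑ a, ∑ d ∈ Finset.Icc 1 (n - 1),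
        if d ∈ Finset.Ico (chainS (C a)) (chainF (C a)) then m d else 0 := Finset.sum_comm
    _ ≤ _ := by
        refine Finset.sum_le_sum fun a _ ↦ ?_
        rw [← Finset.sum_filter]
        exact Finset.sum_le_sum_of_subset fun d hd ↦ (Finset.mem_filter.mp hd).2

/-- A point `x ∈ ℝ_{≥0}^P` satisfies all the subset inequalities defining `X_{𝐦,M}`
iff it satisfies all the chain-collection inequalities. -/
theorem statement0 (n : ℕ) (hn : 2 ≤ n) (m : ℕ → ℕ) (M : ℕ)
    (x : ℕ × ℕ → ℝ) (hx : ∀ α ∈ posetP n, 0 ≤ x α) :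
    (∀ P' ⊆ posetP n,
        ∑ α ∈ P', x α ≤
          (M : ℝ) + ∑ d ∈ Finset.Icc 1 (n - 1), (m d : ℝ) * (finWidth (P' ∩ posetPd n d) : ℝ))
      ↔
    (∀ (r : ℕ) (C : Fin r → Finset (ℕ × ℕ)),
        (∀ a, C a ⊆ posetP n) → (∀ a, (C a).Nonempty) →
        (∀ a, IsChain (· ≤ ·) ((C a : Set (ℕ × ℕ)))) →
        ∑ α ∈ Finset.univ.biUnion C, x α ≤
          (M : ℝ) + ∑ a : Fin r,
            ∑ d ∈ Finset.Ico (chainS (C a)) (chainF (C a)), (m d : ℝ)) := by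
  constructor
  · intro h r C hCP _ hchain
    refine (h _ (Finset.biUnion_subset.mpr fun a _ ↦ hCP a)).trans ?_
    gcongr
    exact_mod_cast sum_mul_finWidth_biUnion_le m hchain
  · intro h Q hQ
    obtain ⟨F, hF, hFc, hFs⟩ := exists_chainFamily n m Q hQ
    have hmem : ∀ a, (F.equivFin.symm a : Finset (ℕ × ℕ)) ∈ F := fun a ↦ (F.equivFin.symm a).2
    have key := h F.card (fun a ↦ (F.equivFin.symm a : Finset (ℕ × ℕ)))
      (fun a ↦ (hF _ (hmem a)).1) (fun a ↦ (hF _ (hmem a)).2.1) (fun a ↦ (hF _ (hmem a)).2.2)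
    have hsum : ∑ a, ∑ d ∈ Finset.Ico (chainS (F.equivFin.symm a : Finset (ℕ × ℕ)))
        (chainF (F.equivFin.symm a : Finset (ℕ × ℕ))), (m d : ℝ) =
        ∑ C ∈ F, ∑ d ∈ Finset.Ico (chainS C) (chainF C), (m d : ℝ) := by
      rw [F.equivFin.symm.sum_comp (fun C : F ↦
        ∑ d ∈ Finset.Ico (chainS (C : Finset (ℕ × ℕ))) (chainF (C : Finset (ℕ × ℕ))), (m d : ℝ))]
      exact F.sum_coe_sort fun C ↦ ∑ d ∈ Finset.Ico (chainS C) (chainF C), (m d : ℝ)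
    rw [hsum] at key
    refine le_trans (Finset.sum_le_sum_of_subset_of_nonneg ?_ ?_) (key.trans ?_)
    · intro p hp
      obtain ⟨C, hC, hpC⟩ := hFc p hp
      exact Finset.mem_biUnion.mpr ⟨F.equivFin ⟨C, hC⟩, Finset.mem_univ _, by simpa using hpC⟩
    · intro p hp _
      obtain ⟨a, -, ha⟩ := Finset.mem_biUnion.mp hp
      exact hx p ((hF _ (hmem a)).1 ha)
    · gcongr
      exact_mod_cast hFs
end

section
/- For every nonempty subset P' ⊆ P there exist pairwise disjoint nonempty chains C_1, …, C_r in P whose union is P' and such that for every d ∈ {1,…,n−1} the number of indices a ∈ {1,…,r} with C_a ∩ P_d ≠ ∅ is exactly the width w(P' ∩ P_d). -/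
/-- The antichains contained in `Q`, all of whose members `(i,j)`, seen as intervals `[j,i)`,
contain the interval of their member `x`. -/
def nestedAbove (Q : Finset (ℕ × ℕ)) (x : ℕ × ℕ) : Set (Finset (ℕ × ℕ)) :=
  {A | A ⊆ Q ∧ IsAntichain (· ≤ ·) (A : Set (ℕ × ℕ)) ∧ x ∈ A ∧ ∀ y ∈ A, x.1 ≤ y.1 ∧ y.2 ≤ x.2}

open Classical in
/-- The maximal cardinality of an antichain in `Q` with innermost interval `x`. -/
noncomputable def nestingDepth (Q : Finset (ℕ × ℕ)) (x : ℕ × ℕ) : ℕ :=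
  (Q.powerset.filter (· ∈ nestedAbove Q x)).sup Finset.card

lemma card_le_nestingDepth {Q A : Finset (ℕ × ℕ)} {x : ℕ × ℕ} (hA : A ∈ nestedAbove Q x) :
    A.card ≤ nestingDepth Q x := by
  classical
  exact Finset.le_sup (f := Finset.card)
    (Finset.mem_filter.2 ⟨Finset.mem_powerset.2 hA.1, hA⟩)

lemma exists_card_eq_nestingDepth {Q : Finset (ℕ × ℕ)} {x : ℕ × ℕ} (hx : x ∈ Q) :
    ∃ A ∈ nestedAbove Q x, A.card = nestingDepth Q x := by
  classical
  have hmem : {x} ∈ Q.powerset.filter (· ∈ nestedAbove Q x) := by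
    refine Finset.mem_filter.2 ⟨by simpa using hx, by simpa using hx, by simp, by simp, ?_⟩
    intro y hy
    rw [Finset.mem_singleton.1 hy]
    exact ⟨le_rfl, le_rfl⟩
  obtain ⟨A, hA, h⟩ := Finset.exists_mem_eq_sup _ ⟨_, hmem⟩ Finset.card
  exact ⟨A, (Finset.mem_filter.1 hA).2, h.symm⟩

lemma one_le_nestingDepth {Q : Finset (ℕ × ℕ)} {x : ℕ × ℕ} (hx : x ∈ Q) :
    1 ≤ nestingDepth Q x := by
  obtain ⟨A, hA, h⟩ := exists_card_eq_nestingDepth hx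
  exact h ▸ Finset.card_pos.2 ⟨x, hA.2.2.1⟩

lemma nestingDepth_lt {Q : Finset (ℕ × ℕ)} {x y : ℕ × ℕ} (hx : x ∈ Q) (hy : y ∈ Q)
    (h₁ : x.1 < y.1) (h₂ : y.2 < x.2) : nestingDepth Q y < nestingDepth Q x := by
  obtain ⟨A, ⟨hAQ, hA, hyA, hout⟩, hcard⟩ := exists_card_eq_nestingDepth hy
  have hxA : x ∉ A := fun h => by have := hout x h; omega
  have key : insert x A ∈ nestedAbove Q x := by
    refine ⟨Finset.insert_subset hx hAQ, ?_, Finset.mem_insert_self _ _, fun z hz => ?_⟩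
    · rw [Finset.coe_insert]
      refine hA.insert (fun z hz _ hle => ?_) (fun z hz _ hle => ?_)
      · have := hout z hz
        have := hle.1
        omega
      · have := hout z hz
        have := hle.2
        omega
    · rcases Finset.mem_insert.1 hz with rfl | hz
      · exact ⟨le_rfl, le_rfl⟩
      · have := hout z hz
        omega
  have := card_le_nestingDepth key
  rw [Finset.card_insert_of_notMem hxA] at this
  omega

lemma le_or_le_of_nestingDepth_eq {Q : Finset (ℕ × ℕ)} {x y : ℕ × ℕ} (hx : x ∈ Q) (hy : y ∈ Q)
    (h : nestingDepth Q x = nestingDepth Q y) : x ≤ y ∨ y ≤ x := by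
  by_contra hc
  simp only [Prod.le_def] at hc
  rcases lt_or_ge x.1 y.1 with h₁ | h₁
  · exact (nestingDepth_lt hx hy h₁ (by omega)).ne h.symm
  · exact (nestingDepth_lt hy hx (by omega) (by omega)).ne h

/-- The depths occurring in `Q ∩ P_d` are as many as the width of `Q ∩ P_d`. -/
lemma card_image_nestingDepth {n d : ℕ} {Q : Finset (ℕ × ℕ)} (hQ : Q ⊆ posetP n) :
    ((Q ∩ posetPd n d).image (nestingDepth Q)).card = finWidth (Q ∩ posetPd n d) := by
  have hle : ∀ A ⊆ Q ∩ posetPd n d, IsAntichain (· ≤ ·) (A : Set (ℕ × ℕ)) →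
      A.card ≤ ((Q ∩ posetPd n d).image (nestingDepth Q)).card := by
    intro A hAQ hA
    have hinj : Set.InjOn (nestingDepth Q) A := by
      intro x hx y hy hxy
      rcases le_or_le_of_nestingDepth_eq (Finset.mem_inter.1 (hAQ hx)).1
        (Finset.mem_inter.1 (hAQ hy)).1 hxy with h | h
      · exact hA.eq hx hy h
      · exact (hA.eq hy hx h).symm
    rw [← Finset.card_image_of_injOn hinj]
    exact Finset.card_le_card (Finset.image_subset_image hAQ)
  have hge : ∃ A ⊆ Q ∩ posetPd n d, IsAntichain (· ≤ ·) (A : Set (ℕ × ℕ)) ∧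
      ((Q ∩ posetPd n d).image (nestingDepth Q)).card ≤ A.card := by
    rcases (Q ∩ posetPd n d).eq_empty_or_nonempty with h | h
    · exact ⟨∅, by simp, by simp, by simp [h]⟩
    obtain ⟨x, hx, hmax⟩ := Finset.exists_max_image _ (nestingDepth Q) h
    obtain ⟨hxQ, hxd⟩ := Finset.mem_inter.1 hx
    obtain ⟨A, ⟨hAQ, hA, -, hout⟩, hcard⟩ := exists_card_eq_nestingDepth hxQ
    refine ⟨A, fun y hy => ?_, hA, ?_⟩
    · have := hout y hy
      have := (Finset.mem_filter.1 hxd).2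
      exact Finset.mem_inter.2 ⟨hAQ hy, Finset.mem_filter.2 ⟨hQ (hAQ hy), by omega, by omega⟩⟩
    · have hsub : (Q ∩ posetPd n d).image (nestingDepth Q) ⊆
          Finset.Icc 1 (nestingDepth Q x) := by
        intro k hk
        obtain ⟨y, hy, rfl⟩ := Finset.mem_image.1 hk
        exact Finset.mem_Icc.2 ⟨one_le_nestingDepth (Finset.mem_inter.1 hy).1, hmax y hy⟩
      simpa [hcard] using Finset.card_le_card hsub
  obtain ⟨A, hAQ, hA, hcard⟩ := hge
  symm
  refine IsGreatest.csSup_eq ⟨⟨A, ⟨hAQ, hA⟩, (hle A hAQ hA).antisymm hcard⟩, ?_⟩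
  rintro _ ⟨B, ⟨hBQ, hB⟩, rfl⟩
  exact hle B hBQ hB

/-- Every nonempty `P' ⊆ P` can be partitioned into pairwise disjoint nonempty chains
`C_1, …, C_r` such that for every `d ∈ {1,…,n-1}` the number of chains meeting `P_d`
equals the width of `P' ∩ P_d`. -/
theorem statement1 (n : ℕ) (hn : 2 ≤ n) (P' : Finset (ℕ × ℕ))
    (hP' : P' ⊆ posetP n) (hne : P'.Nonempty) :
    ∃ (r : ℕ) (C : Fin r → Finset (ℕ × ℕ)),
      (∀ a, (C a).Nonempty) ∧
      (∀ a, IsChain (· ≤ ·) ((C a : Set (ℕ × ℕ)))) ∧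
      (∀ a b, a ≠ b → Disjoint (C a) (C b)) ∧
      Finset.univ.biUnion C = P' ∧
      (∀ d ∈ Finset.Icc 1 (n - 1),
        (Finset.univ.filter (fun a => ((C a) ∩ posetPd n d).Nonempty)).card
          = finWidth (P' ∩ posetPd n d)) := by
  let f := nestingDepth P'
  let e := (P'.image f).equivFin.symm
  have he : ∀ x ∈ P', ∃ a, (e a : ℕ) = f x := fun x hx =>
    ⟨e.symm ⟨f x, Finset.mem_image_of_mem f hx⟩, by simp⟩
  refine ⟨_, fun a => P'.filter (fun x => f x = e a), fun a => ?_, fun a => ?_, fun a b hab => ?_,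
    ?_, fun d _ => ?_⟩
  · obtain ⟨x, hx, h⟩ := Finset.mem_image.1 (e a).2
    exact ⟨x, Finset.mem_filter.2 ⟨hx, h⟩⟩
  · intro x hx y hy _
    obtain ⟨hx, hxa⟩ := Finset.mem_filter.1 hx
    obtain ⟨hy, hya⟩ := Finset.mem_filter.1 hy
    exact le_or_le_of_nestingDepth_eq hx hy (hxa.trans hya.symm)
  · refine Finset.disjoint_left.2 fun x hx hy => hab (e.injective (Subtype.ext ?_))
    exact (Finset.mem_filter.1 hx).2.symm.trans (Finset.mem_filter.1 hy).2
  · ext x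
    simp only [Finset.mem_biUnion, Finset.mem_univ, true_and, Finset.mem_filter]
    exact ⟨fun ⟨_, hx, _⟩ => hx, fun hx => (he x hx).imp fun _ ha => ⟨hx, ha.symm⟩⟩
  · rw [← card_image_nestingDepth hP',
      ← Finset.card_image_of_injective _ (Subtype.val_injective.comp e.injective)]
    congr 1
    ext k
    simp only [Finset.mem_image, Finset.mem_filter, Finset.mem_univ, true_and, Finset.mem_inter,
      Function.comp_apply]
    constructor
    · rintro ⟨a, ⟨x, hxC⟩, rfl⟩
      obtain ⟨hxa, hxd⟩ := Finset.mem_inter.1 hxC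
      obtain ⟨hx, hxa⟩ := Finset.mem_filter.1 hxa
      exact ⟨x, ⟨hx, hxd⟩, hxa⟩
    · rintro ⟨x, ⟨hx, hxd⟩, rfl⟩
      obtain ⟨a, ha⟩ := he x hx
      exact ⟨a, ⟨x, Finset.mem_inter.2 ⟨Finset.mem_filter.2 ⟨hx, ha.symm⟩, hxd⟩⟩, ha⟩
end

section
/- Let 𝐉 = (J_1,…,J_{n−1}) be an admissible collection and let 1 ≤ j < i ≤ n. Then (i ∈ J_j and j ∉ J_{i−1}) if and only if for every d with j ≤ d < i one has i ∈ J_d and j ∉ J_d. -/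
/-- In a sequence with `J d ⊆ J (d + 1) ∪ {d + 1}`, an element of `J a` persists up to `J b`
unless it lies in `(a, b]`. -/
theorem mem_of_mem_of_notMem_Ioc {J : ℕ → Finset ℕ} {a b x : ℕ} (hab : a ≤ b)
    (hJ : ∀ d, a ≤ d → d < b → J d ⊆ J (d + 1) ∪ {d + 1})
    (hx : x ∉ Finset.Ioc a b) (hxa : x ∈ J a) : x ∈ J b := by
  induction b, hab using Nat.le_induction with
  | base => exact hxa
  | succ b hab ih =>
    rw [Finset.mem_Ioc] at hx
    have hxb : x ∈ J b := ih (fun d had hdb => hJ d had (by omega))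
      (by rw [Finset.mem_Ioc]; omega)
    rcases Finset.mem_union.mp (hJ b hab b.lt_succ_self hxb) with h | h
    · exact h
    · rw [Finset.mem_singleton] at h
      omega

/-- For an admissible collection `𝐉 = (J_1, …, J_{n-1})` (each `J_d ⊆ [n]`, `|J_d| = d`,
`J_d ⊆ J_{d+1} ∪ {d+1}`) and `1 ≤ j < i ≤ n`:
`i ∈ J_j ∧ j ∉ J_{i-1}` iff `i ∈ J_d ∧ j ∉ J_d` for every `d` with `j ≤ d < i`. -/
theorem statement6 (n : ℕ) (hn : 2 ≤ n) (J : ℕ → Finset ℕ)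
    (hJsub : ∀ d, 1 ≤ d → d ≤ n - 1 → J d ⊆ Finset.Icc 1 n)
    (hJcard : ∀ d, 1 ≤ d → d ≤ n - 1 → (J d).card = d)
    (hJadm : ∀ d, 1 ≤ d → d ≤ n - 2 → J d ⊆ J (d + 1) ∪ {d + 1})
    (i j : ℕ) (hj : 1 ≤ j) (hji : j < i) (hin : i ≤ n) :
    (i ∈ J j ∧ j ∉ J (i - 1)) ↔ (∀ d, j ≤ d → d < i → i ∈ J d ∧ j ∉ J d) := by
  constructor
  · rintro ⟨hi, hnj⟩ d hjd hdi
    refine ⟨mem_of_mem_of_notMem_Ioc hjd (fun e _ _ => hJadm e (by omega) (by omega)) ?_ hi,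
      fun hjJ => hnj (mem_of_mem_of_notMem_Ioc (by omega)
        (fun e _ _ => hJadm e (by omega) (by omega)) ?_ hjJ)⟩ <;>
    · rw [Finset.mem_Ioc]
      omega
  · intro h
    exact ⟨(h j le_rfl hji).1, (h (i - 1) (by omega) (by omega)).2⟩
end

section
/- Let 𝐉 = (J_1,…,J_{n−1}) be an admissible collection. Then there exists no pair i > j with i ∈ J_j and j ∉ J_{i−1} if and only if J_d = {1,…,d} for every d ∈ {1,…,n−1}. -/
/-- In an admissible collection, an element of `J k` survives up to `J l` unless it lies in the
interval `(k, l]`, since passing from `J d` to `J (d + 1)` can only remove `d + 1`. -/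
theorem mem_of_mem_of_le {n : ℕ} {J : ℕ → Finset ℕ}
    (hJadm : ∀ d, 1 ≤ d → d ≤ n - 2 → J d ⊆ J (d + 1) ∪ {d + 1})
    {k l x : ℕ} (hk : 1 ≤ k) (hkl : k ≤ l) (hl : l ≤ n - 1) (hx : x ∈ J k)
    (hxkl : x ≤ k ∨ l < x) : x ∈ J l := by
  induction l, hkl using Nat.le_induction with
  | base => exact hx
  | succ l hkl ih =>
    have h := hJadm l (by omega) (by omega) (ih (by omega) (by omega))
    rw [Finset.mem_union, Finset.mem_singleton] at h
    exact h.resolve_right (by omega)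


/-- For an admissible collection `𝐉 = (J_1, …, J_{n-1})` (each `J_d ⊆ [n]`, `|J_d| = d`,
`J_d ⊆ J_{d+1} ∪ {d+1}`): there is no pair `i > j` with `i ∈ J_j` and `j ∉ J_{i-1}`
if and only if `J_d = {1, …, d}` for every `d ∈ {1, …, n-1}`. -/
theorem statement7 (n : ℕ) (hn : 2 ≤ n) (J : ℕ → Finset ℕ)
    (hJsub : ∀ d, 1 ≤ d → d ≤ n - 1 → J d ⊆ Finset.Icc 1 n)
    (hJcard : ∀ d, 1 ≤ d → d ≤ n - 1 → (J d).card = d)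
    (hJadm : ∀ d, 1 ≤ d → d ≤ n - 2 → J d ⊆ J (d + 1) ∪ {d + 1}) :
    (¬ ∃ i j : ℕ, 1 ≤ j ∧ j < i ∧ i ≤ n ∧ i ∈ J j ∧ j ∉ J (i - 1)) ↔
      (∀ d, 1 ≤ d → d ≤ n - 1 → J d = Finset.Icc 1 d) := by
  constructor
  · intro h d
    push Not at h
    induction d using Nat.strong_induction_on with
    | _ s ih =>
      intro hs hsn
      have hlow : ∀ x l, 1 ≤ x → x < s → s ≤ l → l ≤ n - 1 → x ∈ J l := by
        intro x l hx hxs hsl hl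
        have hmem : x ∈ J x := by
          rw [ih x hxs hx (by omega)]
          exact Finset.mem_Icc.mpr ⟨hx, le_rfl⟩
        exact mem_of_mem_of_le hJadm hx (by omega) hl hmem (Or.inl le_rfl)
      refine Finset.eq_of_subset_of_card_le (fun i hi => ?_) (by simp [hJcard s hs hsn])
      have hin := Finset.mem_Icc.mp (hJsub s hs hsn hi)
      refine Finset.mem_Icc.mpr ⟨hin.1, ?_⟩
      by_contra! hsi
      have hsub : Finset.Icc 1 i ⊆ J (i - 1) := by
        intro x hx
        obtain ⟨hx1, hxi⟩ := Finset.mem_Icc.mp hx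
        rcases lt_or_ge x s with hxs | hxs
        · exact hlow x (i - 1) hx1 hxs (by omega) (by omega)
        · rcases hxi.eq_or_lt with rfl | hxi
          · exact mem_of_mem_of_le hJadm hs (by omega) (by omega) hi (Or.inr (by omega))
          · exact h i x hx1 hxi hin.2
              (mem_of_mem_of_le hJadm hs hxs (by omega) hi (Or.inr hxi))
      have hcard := Finset.card_le_card hsub
      rw [hJcard (i - 1) (by omega) (by omega), Nat.card_Icc] at hcard
      omega
  · rintro h ⟨i, j, hj, hji, hin, hi, -⟩
    rw [h j hj (by omega), Finset.mem_Icc] at hi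
    omega
end
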